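/- arXiv:math/0105139 — 2 statements merged into one kernel-verified Lean document; each statement's English description precedes it below -/
import Mathlib

section
/- Let G1 and G2 be nontrivial groups and let g be an element of the free product G1 * G2 that is not conjugate to an element of the canonical image of G1 nor to an element of the canonical image of G2. Then the centralizer of g in G1 * G2 is an infinite cyclic group. -/
open Monoid

namespace FPC

universe u v

/-- centralizer is generated by an element of infinite order -/
def Concl {A : Type*} [Group A] (g : A) : Prop :=
  ∃ z : A, (∀ h, Commute h g ↔ h ∈ Subgroup.zpowers z) ∧ ¬ IsOfFinOrder z

theorem Concl.transfer {A B : Type*} [Group A] [Group B] (e : A ≃* B) {g : A}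
    (h : Concl (e g)) : Concl g := by
  obtain ⟨z, hz, hf⟩ := h
  refine ⟨e.symm z, fun h => ?_, ?_⟩
  · have h1 : Commute h g ↔ Commute (e h) (e g) := by
      unfold Commute SemiconjBy
      rw [← map_mul, ← map_mul, e.injective.eq_iff]
    rw [h1, hz, Subgroup.mem_zpowers_iff, Subgroup.mem_zpowers_iff]
    refine exists_congr fun k => ?_
    rw [← map_zpow, MulEquiv.symm_apply_eq]
  · intro hh
    apply hf
    have := e.toMonoidHom.isOfFinOrder hh
    simpa using this

variable {M : Bool → Type u} [∀ b, Group (M b)]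

def P (l : List (Σ b, M b)) : CoprodI M := (l.map fun x => CoprodI.of x.2).prod

theorem P_append (l l' : List (Σ b, M b)) : P (l ++ l') = P l * P l' := by simp [P]
theorem P_cons (x : Σ b, M b) (l : List (Σ b, M b)) : P (x :: l) = CoprodI.of x.2 * P l := by
  simp [P]
theorem P_nil : P ([] : List (Σ b, M b)) = 1 := by simp [P]

/-- alternating words starting with type `i` -/
def Alt : Bool → List (Σ b, M b) → Prop
  | _, [] => True
  | i, x :: l => x.1 = i ∧ x.2 ≠ 1 ∧ Alt (!i) l

theorem Alt_append (l l' : List (Σ b, M b)) (i : Bool) :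
    Alt i (l ++ l') ↔ Alt i l ∧ Alt (Bool.not^[l.length] i) l' := by
  induction l generalizing i with
  | nil => simp [Alt]
  | cons x l ih => simp [Alt, ih, and_assoc]

theorem not_iter_even {n : ℕ} (h : Even n) (i : Bool) : Bool.not^[n] i = i := by
  have : Function.Involutive Bool.not := Bool.not_not
  rw [this.iterate_even h]; rfl

theorem not_iter_odd {n : ℕ} (h : Odd n) (i : Bool) : Bool.not^[n] i = !i := by
  have : Function.Involutive Bool.not := Bool.not_not
  rw [this.iterate_odd h]

theorem Alt_chain (l : List (Σ b, M b)) (i : Bool) (h : Alt i l) :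
    (∀ x ∈ l, x.2 ≠ 1) ∧ l.IsChain (fun a b => a.1 ≠ b.1) := by
  induction l generalizing i with
  | nil => simp
  | cons x l ih =>
    obtain ⟨h1, h2, h3⟩ := h
    obtain ⟨h4, h5⟩ := ih _ h3
    refine ⟨by simpa using ⟨h2, h4⟩, ?_⟩
    cases l with
    | nil => simp
    | cons y l =>
      obtain ⟨h6, -, -⟩ := h3
      refine List.IsChain.cons_cons ?_ h5
      rw [h1, h6]; simp

theorem chain_Alt (l : List (Σ b, M b)) (h1 : ∀ x ∈ l, x.2 ≠ 1)
    (h2 : l.IsChain (fun a b => a.1 ≠ b.1)) : ∃ i, Alt i l := by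
  induction l with
  | nil => exact ⟨true, trivial⟩
  | cons x l ih =>
    obtain ⟨i, hi⟩ := ih (fun y hy => h1 y (by simp [hy])) h2.tail
    refine ⟨x.1, rfl, h1 x (by simp), ?_⟩
    cases l with
    | nil => trivial
    | cons y l =>
      have h3 : x.1 ≠ y.1 := by
        cases h2; assumption
      obtain ⟨h4, h5⟩ := hi
      have : (!x.1) = i := by
        rw [← h4]; revert h3; cases x.1 <;> cases y.1 <;> simp
      rw [this]; exact ⟨h4, h5⟩

theorem Alt_unique {l l' : List (Σ b, M b)} {i j : Bool} (h : Alt i l) (h' : Alt j l')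
    (e : P l = P l') : l = l' := by
  classical
  have a := Alt_chain l i h
  have b := Alt_chain l' j h'
  have : (⟨l, a.1, a.2⟩ : CoprodI.Word M) = ⟨l', b.1, b.2⟩ :=
    CoprodI.Word.equiv.symm.injective e
  exact congrArg CoprodI.Word.toList this

theorem exists_Alt (g : CoprodI M) : ∃ i, ∃ l : List (Σ b, M b), Alt i l ∧ P l = g := by
  classical
  let w := CoprodI.Word.equiv g
  obtain ⟨i, hi⟩ := chain_Alt w.toList w.ne_one w.chain_ne
  exact ⟨i, w.toList, hi, CoprodI.Word.equiv.symm_apply_apply g⟩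

def inv (l : List (Σ b, M b)) : List (Σ b, M b) := (l.map fun x => ⟨x.1, x.2⁻¹⟩).reverse

theorem inv_length (l : List (Σ b, M b)) : (inv l).length = l.length := by simp [inv]

theorem P_inv (l : List (Σ b, M b)) : P (inv l) = (P l)⁻¹ := by
  induction l with
  | nil => simp [P, inv]
  | cons x l ih =>
    have : inv (x :: l) = inv l ++ [⟨x.1, x.2⁻¹⟩] := by simp [inv]
    rw [this, P_append, ih, P_cons, P_cons, P_nil]; simp

theorem Alt_inv (l : List (Σ b, M b)) (i : Bool) (h : Alt i l) :
    Alt (Bool.not^[l.length + 1] i) (inv l) := by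
  induction l generalizing i with
  | nil => trivial
  | cons x l ih =>
    obtain ⟨h1, h2, h3⟩ := h
    have : inv (x :: l) = inv l ++ [⟨x.1, x.2⁻¹⟩] := by simp [inv]
    rw [this, Alt_append]
    refine ⟨by simpa using ih _ h3, ?_, by simpa using h2, trivial⟩
    rw [h1, inv_length, ← Function.iterate_add_apply, not_iter_even]
    simp only [List.length_cons]
    exact ⟨l.length + 1, by ring⟩

theorem exists_cyc (g : CoprodI M) (hg : ∀ b (x : M b), ¬ IsConj (CoprodI.of x) g)
    (n : ℕ) (i : Bool) (l : List (Σ b, M b)) (hn : l.length = n) (hl : Alt i l)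
    (hc : IsConj (P l) g) :
    ∃ i, ∃ l : List (Σ b, M b), Alt i l ∧ Even l.length ∧ l ≠ [] ∧ IsConj (P l) g := by
  induction n using Nat.strong_induction_on generalizing i l with
  | _ n ih =>
  have hne : l ≠ [] := by
    rintro rfl
    apply hg true 1
    simpa [P] using hc
  rcases Nat.even_or_odd l.length with he | ho
  · exact ⟨i, l, hl, he, hne, hc⟩
  cases l with
  | nil => exact absurd rfl hne
  | cons x t =>
  rcases List.eq_nil_or_concat t with rfl | ⟨t, y, rfl⟩
  · exact absurd (by simpa [P] using hc) (hg x.1 x.2)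
  obtain ⟨h1, h2, h3⟩ := hl
  simp only [List.concat_eq_append] at *
  have hto : Odd t.length := by
    simp only [List.length_cons, List.length_append, List.length_nil] at ho
    rw [Nat.odd_iff] at *; omega
  rw [Alt_append, not_iter_odd hto] at h3
  obtain ⟨h3, h4, h5, -⟩ := h3
  obtain ⟨a, x⟩ := x
  obtain ⟨b, y⟩ := y
  simp only [Bool.not_not] at h1 h4 h5
  subst h1
  subst h4
  have hc' : IsConj (P t * CoprodI.of (y * x)) g := by
    refine IsConj.trans ?_ hc
    rw [isConj_iff]
    refine ⟨CoprodI.of x, ?_⟩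
    simp [P, mul_assoc]
  by_cases hyx : y * x = 1
  · rw [hyx, map_one, mul_one] at hc'
    refine ih t.length ?_ _ t rfl h3 hc'
    rw [← hn]; simp
  · refine ⟨!b, t ++ [⟨b, y * x⟩], ?_, ?_, by simp, ?_⟩
    · rw [Alt_append, not_iter_odd hto]
      exact ⟨h3, by simp, hyx, trivial⟩
    · simp only [List.length_append, List.length_cons, List.length_nil]
      exact hto.add_odd (by simp)
    · simpa [P] using hc'

theorem prefix_of_comm {α : Type*} {w u v : List α} (hw : w ≠ []) (hu : u ++ w = w ++ u)
    (hv : v ++ w = w ++ v) (h : u.length ≤ v.length) : u <+: v := by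
  have key : ∀ N : ℕ, ∃ W : List α, N ≤ W.length ∧ ∀ u, u ++ w = w ++ u → u ++ W = W ++ u := by
    intro N
    induction N with
    | zero => exact ⟨[], by simp, by simp⟩
    | succ N ih =>
      obtain ⟨W, h1, h2⟩ := ih
      refine ⟨w ++ W, ?_, fun u hu => ?_⟩
      · have := List.length_pos_iff.2 hw
        simp; omega
      · rw [← List.append_assoc, hu, List.append_assoc, h2 u hu, List.append_assoc]
  obtain ⟨W, h1, h2⟩ := key v.length
  have pre : ∀ u, u ++ w = w ++ u → u.length ≤ W.length → u <+: W := by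
    intro u hu hl
    refine List.prefix_of_prefix_length_le (l₃ := u ++ W) (List.prefix_append _ _) ?_ hl
    rw [h2 u hu]; exact List.prefix_append _ _
  exact List.prefix_of_prefix_length_le (pre u hu (h.trans h1)) (pre v hv h1) h

/-- cyclic words -/
def D (i : Bool) (l : List (Σ b, M b)) : Prop := Alt i l ∧ Even l.length

theorem D.append {i : Bool} {l l' : List (Σ b, M b)} (h : D i l) (h' : D i l') :
    D i (l ++ l') := by
  refine ⟨?_, by simpa using h.2.add h'.2⟩
  rw [Alt_append, not_iter_even h.2]
  exact ⟨h.1, h'.1⟩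

theorem D.comm {i : Bool} {l l' : List (Σ b, M b)} (h : D i l) (h' : D i l')
    (c : Commute (P l) (P l')) : l ++ l' = l' ++ l := by
  refine Alt_unique (h.append h').1 (h'.append h).1 ?_
  rw [P_append, P_append, c.eq]

theorem D_cover {i : Bool} {w : List (Σ b, M b)} (hw : D i w) (hne : w ≠ [])
    (h : CoprodI M) (hc : Commute h (P w)) : ∃ l, D i l ∧ (P l = h ∨ P l = h⁻¹) := by
  obtain ⟨j, l, hl, rfl⟩ := exists_Alt h
  have hinv : Alt (!i) (inv w) := by
    have := Alt_inv w i hw.1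
    rwa [not_iter_odd hw.2.add_one] at this
  have hwl := List.length_pos_iff.2 hne
  rcases Nat.even_or_odd l.length with he | ho
  · by_cases hji : j = i
    · subst hji
      exact ⟨l, ⟨hl, he⟩, Or.inl rfl⟩
    · have hj : j = !i := by revert hji; cases i <;> cases j <;> simp
      refine ⟨inv l, ⟨?_, by rwa [inv_length]⟩, Or.inr (P_inv l)⟩
      have := Alt_inv l j hl
      rwa [not_iter_odd he.add_one, hj, Bool.not_not] at this
  · exfalso
    by_cases hji : j = i
    · subst hji
      have h1 : Alt j (w ++ (l ++ inv w)) := by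
        rw [Alt_append, Alt_append, not_iter_even hw.2, not_iter_odd ho]
        exact ⟨hw.1, hl, hinv⟩
      have := Alt_unique h1 hl (by
        rw [P_append, P_append, P_inv, ← mul_assoc, ← hc.eq, mul_inv_cancel_right])
      have := congrArg List.length this
      simp at this
      omega
    · have hj : j = !i := by revert hji; cases i <;> cases j <;> simp
      subst hj
      have h1 : Alt (!i) (inv w ++ (l ++ w)) := by
        rw [Alt_append, Alt_append, not_iter_even (by rw [inv_length]; exact hw.2),
          not_iter_odd ho, Bool.not_not]
        exact ⟨hinv, hl, hw.1⟩
      have := Alt_unique h1 hl (by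
        rw [P_append, P_append, P_inv, hc.eq, inv_mul_cancel_left])
      have := congrArg List.length this
      simp at this
      omega

theorem D.pow {i : Bool} {z : List (Σ b, M b)} (h : D i z) (n : ℕ) :
    ∃ l, D i l ∧ l.length = n * z.length ∧ P l = P z ^ n := by
  induction n with
  | zero => exact ⟨[], ⟨trivial, by simp⟩, by simp, by simp [P]⟩
  | succ n ih =>
    obtain ⟨l, h1, h2, h3⟩ := ih
    refine ⟨l ++ z, h1.append h, ?_, ?_⟩
    · simp [h2]; ring
    · rw [P_append, h3, pow_succ]

theorem concl_cyc {i : Bool} {w : List (Σ b, M b)} (hw : D i w) (hne : w ≠ []) :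
    Concl (P w) := by
  classical
  have hex : ∃ n, ∃ z : List (Σ b, M b), z.length = n ∧ z ≠ [] ∧ D i z ∧ Commute (P z) (P w) :=
    ⟨_, w, rfl, hne, hw, Commute.refl _⟩
  obtain ⟨z, hzn, hz0, hz, hzc⟩ := Nat.find_spec hex
  have hmin : ∀ u : List (Σ b, M b), u ≠ [] → D i u → Commute (P u) (P w) →
      z.length ≤ u.length := by
    intro u h1 h2 h3
    rw [hzn]
    exact Nat.find_min' hex ⟨u, rfl, h1, h2, h3⟩
  have hgen : ∀ n, ∀ u : List (Σ b, M b), u.length = n → D i u → Commute (P u) (P w) →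
      P u ∈ Subgroup.zpowers (P z) := by
    intro n
    induction n using Nat.strong_induction_on with
    | _ n ih =>
    intro u hn hu huc
    by_cases hu0 : u = []
    · subst hu0; rw [P_nil]; exact one_mem _
    obtain ⟨u', rfl⟩ := prefix_of_comm hne (hz.comm hw hzc) (hu.comm hw huc) (hmin u hu0 hu huc)
    have hz1 := List.length_pos_iff.2 hz0
    have e : P u' = (P z)⁻¹ * P (z ++ u') := by rw [P_append]; group
    have hd : D i u' := by
      obtain ⟨h1, h2⟩ := hu
      rw [Alt_append, not_iter_even hz.2] at h1
      refine ⟨h1.2, ?_⟩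
      rw [List.length_append, Nat.even_add] at h2
      exact h2.1 hz.2
    have hcu : Commute (P u') (P w) := by
      rw [e]; exact hzc.inv_left.mul_left huc
    have := ih u'.length (by rw [← hn]; simp; omega) u' rfl hd hcu
    rw [P_append]
    exact mul_mem (Subgroup.mem_zpowers _) this
  refine ⟨P z, fun h => ⟨fun hc => ?_, ?_⟩, ?_⟩
  · obtain ⟨l, hl, e | e⟩ := D_cover hw hne h hc
    · rw [← e]; exact hgen _ l rfl hl (e ▸ hc)
    · rw [← inv_mem_iff, ← e]; exact hgen _ l rfl hl (e ▸ hc.inv_left)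
  · rintro ⟨k, rfl⟩
    exact hzc.zpow_left k
  · rw [isOfFinOrder_iff_pow_eq_one]
    rintro ⟨n, hn, h1⟩
    obtain ⟨l, hl, hlen, hP⟩ := hz.pow n
    have : l = [] := Alt_unique (j := i) hl.1 trivial (by rw [hP, h1, P_nil])
    subst this
    have hz1 := List.length_pos_iff.2 hz0
    have := Nat.mul_pos hn hz1
    rw [List.length_nil] at hlen
    omega

theorem concl_coprodI (g : CoprodI M) (hg : ∀ b (x : M b), ¬ IsConj (CoprodI.of x) g) :
    Concl g := by
  obtain ⟨i, l, hl, hP⟩ := exists_Alt g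
  obtain ⟨j, w, h1, h2, h3, h4⟩ := exists_cyc g hg _ i l rfl hl (hP ▸ IsConj.refl _)
  obtain ⟨c, hc⟩ := isConj_iff.1 h4.symm
  apply Concl.transfer (MulAut.conj c)
  rw [MulAut.conj_apply, hc]
  exact concl_cyc ⟨h1, h2⟩ h3

/-- the two factors as a family -/
def Fam (G₁ : Type u) (G₂ : Type v) : Bool → Type (max u v)
  | true => ULift.{v} G₁
  | false => ULift.{u} G₂

instance (G₁ : Type u) (G₂ : Type v) [Group G₁] [Group G₂] : ∀ b, Group (Fam G₁ G₂ b)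
  | true => inferInstanceAs (Group (ULift.{v} G₁))
  | false => inferInstanceAs (Group (ULift.{u} G₂))

section
variable (G₁ : Type u) (G₂ : Type v) [Group G₁] [Group G₂]

def iT : G₁ ≃* Fam G₁ G₂ true := (MulEquiv.ulift : ULift.{v} G₁ ≃* G₁).symm
def iF : G₂ ≃* Fam G₁ G₂ false := (MulEquiv.ulift : ULift.{u} G₂ ≃* G₂).symm

def toI : Monoid.Coprod G₁ G₂ →* CoprodI (Fam G₁ G₂) :=
  Coprod.lift (CoprodI.of.comp (iT G₁ G₂).toMonoidHom) (CoprodI.of.comp (iF G₁ G₂).toMonoidHom)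

def back : ∀ b, Fam G₁ G₂ b →* Monoid.Coprod G₁ G₂
  | true => Coprod.inl.comp (iT G₁ G₂).symm.toMonoidHom
  | false => Coprod.inr.comp (iF G₁ G₂).symm.toMonoidHom

def ofI : CoprodI (Fam G₁ G₂) →* Monoid.Coprod G₁ G₂ := CoprodI.lift (back G₁ G₂)

def equivI : Monoid.Coprod G₁ G₂ ≃* CoprodI (Fam G₁ G₂) :=
  MonoidHom.toMulEquiv (toI G₁ G₂) (ofI G₁ G₂)
    (by
      apply Coprod.hom_ext <;> ext x <;> simp [toI, ofI, back])
    (by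
      apply CoprodI.ext_hom
      rintro (_ | _) <;> ext x <;> simp [toI, ofI, back])

end

end FPC

/-- If `G₁` and `G₂` are nontrivial groups and `g ∈ G₁ ∗ G₂` is not conjugate to an element
of the canonical image of `G₁` nor of `G₂`, then the centralizer of `g` is infinite cyclic. -/
theorem centralizer_infinite_cyclic_of_not_conj_to_factor
    (G₁ G₂ : Type*) [Group G₁] [Group G₂] [Nontrivial G₁] [Nontrivial G₂]
    (g : Monoid.Coprod G₁ G₂)
    (h₁ : ∀ x : G₁, ¬ IsConj (Coprod.inl x) g)
    (h₂ : ∀ y : G₂, ¬ IsConj (Coprod.inr y) g) :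
    Nonempty ((Subgroup.centralizer {g} : Subgroup (Monoid.Coprod G₁ G₂)) ≃* Multiplicative ℤ) := by
  have key : FPC.Concl g := by
    apply FPC.Concl.transfer (FPC.equivI G₁ G₂)
    apply FPC.concl_coprodI
    intro b x hx
    have h := MonoidHom.map_isConj (FPC.ofI G₁ G₂) hx
    have e : FPC.ofI G₁ G₂ (FPC.equivI G₁ G₂ g) = g := (FPC.equivI G₁ G₂).symm_apply_apply g
    rw [e] at h
    cases b with
    | true => exact h₁ ((FPC.iT G₁ G₂).symm x) (by simpa [FPC.ofI, FPC.back] using h)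
    | false => exact h₂ ((FPC.iF G₁ G₂).symm x) (by simpa [FPC.ofI, FPC.back] using h)
  obtain ⟨z, hz, hf⟩ := key
  have hC : Subgroup.centralizer {g} = Subgroup.zpowers z := by
    ext h
    rw [← hz, Subgroup.mem_centralizer_singleton_iff]
    exact Iff.rfl
  rw [hC]
  have hinj : Function.Injective (zpowersHom _ z) := by
    intro a b hab
    exact (injective_zpow_iff_not_isOfFinOrder.2 hf) hab
  exact ⟨(MonoidHom.ofInjective hinj).symm⟩
end

section
/- Let G be a group that is a free product G = A * B with A and B nontrivial, and let g ∈ G be an element whose conjugacy class does not meet the images of A or of B. Then the centralizer of g in G contains g and is generated by a single element; moreover g is a power of a generator of this centralizer. -/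
open Monoid

namespace CentFP

/-- Centralizers in the free monoid are cyclic. -/
theorem list_root {α : Type*} (w : List α) (hw : w ≠ []) :
    ∃ r : FreeMonoid α, r * FreeMonoid.ofList w = FreeMonoid.ofList w * r ∧
      ∀ X : FreeMonoid α, X * FreeMonoid.ofList w = FreeMonoid.ofList w * X → ∃ k : ℕ, X = r ^ k := by
  classical
  set v : FreeMonoid α := FreeMonoid.ofList w with hv
  have hvl : v.length ≠ 0 := by
    simpa [hv, FreeMonoid.length] using hw
  have hex : ∃ n, ∃ r : FreeMonoid α, Commute r v ∧ r.length ≠ 0 ∧ r.length = n :=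
    ⟨_, v, Commute.refl _, hvl, rfl⟩
  obtain ⟨r, hr, hr0, hrn⟩ := Nat.find_spec hex
  have hmin : ∀ X : FreeMonoid α, Commute X v → X.length ≠ 0 → r.length ≤ X.length := by
    intro X hX hX0
    rw [hrn]
    exact Nat.find_min' hex ⟨X, hX, hX0, rfl⟩
  have hpow : ∀ k : ℕ, (v ^ k).length = k * v.length := by
    intro k
    induction k with
    | zero => simp
    | succ k ih => rw [pow_succ, FreeMonoid.length_mul, ih]; ring
  have hpre : ∀ (X : FreeMonoid α), Commute X v → ∀ k, X.length ≤ k →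
      X.toList <+: (v ^ k).toList := by
    intro X hX k hk
    have h := (hX.pow_right k).eq
    have h1 : X.toList <+: (X * v ^ k).toList := by
      rw [FreeMonoid.toList_mul]; exact List.prefix_append _ _
    have h2 : (v ^ k).toList <+: (X * v ^ k).toList := by
      rw [h, FreeMonoid.toList_mul]; exact List.prefix_append _ _
    refine List.prefix_of_prefix_length_le h1 h2 ?_
    change X.length ≤ (v ^ k).length
    rw [hpow]
    exact hk.trans (Nat.le_mul_of_pos_right _ (Nat.pos_of_ne_zero hvl))
  refine ⟨r, hr.eq, ?_⟩
  have key : ∀ n, ∀ X : FreeMonoid α, X.length ≤ n → Commute X v → ∃ k : ℕ, X = r ^ k := by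
    intro n
    induction n with
    | zero =>
      intro X hX _
      exact ⟨0, by simpa using FreeMonoid.length_eq_zero.1 (Nat.le_zero.1 hX)⟩
    | succ n ih =>
      intro X hX hc
      by_cases h0 : X.length = 0
      · exact ⟨0, by simpa using FreeMonoid.length_eq_zero.1 h0⟩
      have hle := hmin X hc h0
      obtain ⟨Y, hY⟩ := List.prefix_of_prefix_length_le (hpre r hr X.length hle)
        (hpre X hc X.length le_rfl) hle
      have hXY : X = r * FreeMonoid.ofList Y := hY.symm
      have hYc : Commute (FreeMonoid.ofList Y) v := by
        have h := hc.eq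
        rw [hXY, mul_assoc, ← mul_assoc v, ← hr.eq, mul_assoc] at h
        exact mul_left_cancel h
      have hl := congrArg FreeMonoid.length hXY
      rw [FreeMonoid.length_mul] at hl
      obtain ⟨k, hk⟩ := ih _ (by omega) hYc
      exact ⟨k + 1, by rw [hXY, hk, pow_succ']⟩
  exact fun X hX => key _ X le_rfl hX

variable {ι : Type*} {G : ι → Type*} [∀ i, Group (G i)]

/-- product of a list of letters -/
def P (L : List (Σ i, G i)) : CoprodI G := (L.map fun l => CoprodI.of l.2).prod

theorem P_append (L M : List (Σ i, G i)) : P (L ++ M) = P L * P M := by simp [P]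

theorem P_cons (a : Σ i, G i) (M : List (Σ i, G i)) : P (a :: M) = CoprodI.of a.2 * P M := by
  simp [P]

/-- reduced lists -/
def Red (L : List (Σ i, G i)) : Prop :=
  (∀ l ∈ L, l.2 ≠ 1) ∧ L.IsChain (fun a b => a.1 ≠ b.1)

theorem P_inj {L M : List (Σ i, G i)} (hL : Red L) (hM : Red M) (h : P L = P M) : L = M := by
  classical
  let L' : CoprodI.Word G := ⟨L, hL.1, hL.2⟩
  let M' : CoprodI.Word G := ⟨M, hM.1, hM.2⟩
  have : L' = M' := CoprodI.Word.equiv.symm.injective h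
  exact congrArg CoprodI.Word.toList this

theorem shorten (L : List (Σ i, G i)) : Red L ∨ ∃ L', P L' = P L ∧ L'.length < L.length := by
  induction L with
  | nil => left; simp [Red]
  | cons a L ih =>
    rcases ih with hL | ⟨L', h, hl⟩
    · by_cases ha : a.2 = 1
      · right; exact ⟨L, by simp [P_cons, ha], by simp⟩
      cases L with
      | nil => left; simpa [Red] using ha
      | cons b L =>
        by_cases hab : a.1 = b.1
        · right
          obtain ⟨i, x⟩ := a
          obtain ⟨j, y⟩ := b
          obtain rfl : i = j := hab
          exact ⟨⟨i, x * y⟩ :: L, by simp [P_cons, mul_assoc], by simp⟩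
        · left
          refine ⟨?_, ?_⟩
          · intro l hl
            rcases List.mem_cons.1 hl with rfl | hl
            · exact ha
            · exact hL.1 l hl
          · exact List.isChain_cons_cons.2 ⟨hab, hL.2⟩
    · right
      exact ⟨a :: L', by simp [P_cons, h], by simpa using hl⟩

theorem exists_red (L : List (Σ i, G i)) : ∃ M, Red M ∧ P M = P L := by
  classical
  induction hn : L.length using Nat.strong_induction_on generalizing L with
  | _ n ih =>
    rcases shorten L with h | ⟨L', h, hl⟩
    · exact ⟨L, h, rfl⟩
    · obtain ⟨M, hM, hP⟩ := ih _ (hn ▸ hl) L' rfl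
      exact ⟨M, hM, hP.trans h⟩

theorem P_surj (x : CoprodI G) : ∃ M, Red M ∧ P M = x := by
  classical
  let w := CoprodI.Word.equiv x
  exact ⟨w.toList, ⟨w.ne_one, w.chain_ne⟩, CoprodI.Word.equiv.symm_apply_apply x⟩

theorem red_of_length {L W : List (Σ i, G i)} (hW : Red W) (h : P L = P W)
    (hl : L.length = W.length) : L = W := by
  have key : ∀ n, ∀ L : List (Σ i, G i), L.length = n → P L = P W → L = W ∨ W.length < L.length := by
    intro n
    induction n using Nat.strong_induction_on with
    | _ n ih =>
      intro L hn h
      rcases shorten L with hL | ⟨L', h', hlt⟩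
      · exact Or.inl (P_inj hL hW h)
      · right
        rcases ih _ (hn ▸ hlt) L' rfl (h'.trans h) with rfl | h2
        · exact hlt
        · omega
  rcases key _ L rfl h with h | h
  · exact h
  · omega

/-- inverse list -/
def linv (L : List (Σ i, G i)) : List (Σ i, G i) :=
  (L.map fun l => (⟨l.1, l.2⁻¹⟩ : Σ i, G i)).reverse

theorem linv_append (L M : List (Σ i, G i)) : linv (L ++ M) = linv M ++ linv L := by
  simp [linv]

theorem linv_linv (L : List (Σ i, G i)) : linv (linv L) = L := by
  simp [linv, Function.comp_def]

theorem P_linv (L : List (Σ i, G i)) : P (linv L) = (P L)⁻¹ := by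
  induction L with
  | nil => simp [linv, P]
  | cons a L ih =>
    have : linv (a :: L) = linv L ++ [⟨a.1, a.2⁻¹⟩] := by simp [linv]
    rw [this, P_append, ih, P_cons]
    simp [P]

theorem Red.linv {L : List (Σ i, G i)} (h : Red L) : Red (linv L) := by
  refine ⟨?_, ?_⟩
  · intro l hl
    simp only [CentFP.linv, List.mem_reverse, List.mem_map] at hl
    obtain ⟨m, hm, rfl⟩ := hl
    simpa using h.1 m hm
  · rw [CentFP.linv, List.isChain_reverse, List.isChain_map]
    exact h.2.imp fun a b hab => hab.symm

theorem red_append {L M : List (Σ i, G i)} (hL : Red L) (hM : Red M)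
    (h : ∀ x ∈ L.getLast?, ∀ y ∈ M.head?, x.1 ≠ y.1) : Red (L ++ M) := by
  refine ⟨?_, List.isChain_append.2 ⟨hL.2, hM.2, h⟩⟩
  intro l hl
  rcases List.mem_append.1 hl with hl | hl
  · exact hL.1 l hl
  · exact hM.1 l hl

theorem comm_of_red {X W : List (Σ i, G i)} (h : Red (X ++ W)) (hc : Commute (P X) (P W)) :
    X ++ W = W ++ X := by
  symm
  refine red_of_length h ?_ ?_
  · rw [P_append, P_append, hc.eq]
  · simp [add_comm]

/-- centralizer of a cyclically reduced element -/
theorem cyc_case (a b : Σ i, G i) (M : List (Σ i, G i)) (hab : a.1 ≠ b.1)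
    (hW : Red (a :: (M ++ [b]))) :
    ∃ c : CoprodI G, ∀ x : CoprodI G, Commute x (P (a :: (M ++ [b]))) ↔ ∃ k : ℤ, x = c ^ k := by
  set W := a :: (M ++ [b]) with hWdef
  obtain ⟨r, hr, hroot⟩ := list_root W (by simp [W])
  have hPpow : ∀ k : ℕ, P (r ^ k).toList = P r.toList ^ k := by
    intro k
    induction k with
    | zero => simp [P]
    | succ k ih => rw [pow_succ, FreeMonoid.toList_mul, P_append, ih, pow_succ]
  have hrc : Commute (P r.toList) (P W) := by
    have h := congrArg (fun L : FreeMonoid (Σ i, G i) => P L.toList) hr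
    simp only [FreeMonoid.toList_mul, P_append, FreeMonoid.toList_ofList] at h
    exact h
  refine ⟨P r.toList, fun x => ⟨fun hx => ?_, ?_⟩⟩
  · obtain ⟨X, hX, rfl⟩ := P_surj x
    have main : X ++ W = W ++ X ∨ linv X ++ W = W ++ linv X := by
      by_cases hlast : ∀ x ∈ X.getLast?, x.1 ≠ a.1
      · left
        refine comm_of_red (red_append hX hW ?_) hx
        intro x hx y hy
        have : a = y := by simpa [W] using hy
        exact this ▸ hlast x hx
      · right
        push Not at hlast
        obtain ⟨z, hz, hza⟩ := hlast
        have h2 : X ++ linv W = linv W ++ X := by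
          refine comm_of_red (red_append hX hW.linv ?_) ?_
          · intro x hx y hy
            have hxz : x = z := Option.mem_unique hx hz
            have : (⟨b.1, b.2⁻¹⟩ : Σ i, G i) = y := by simpa [W, linv] using hy
            rw [← this, hxz, hza]
            exact hab
          · rw [P_linv]; exact hx.inv_right
        have h3 := congrArg linv h2
        rw [linv_append, linv_append, linv_linv] at h3
        exact h3.symm
    rcases main with h | h
    · obtain ⟨k, hk⟩ := hroot (FreeMonoid.ofList X) h
      refine ⟨k, ?_⟩
      have := hPpow k
      rw [← hk] at this
      simpa using this
    · obtain ⟨k, hk⟩ := hroot (FreeMonoid.ofList (linv X)) h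
      refine ⟨-k, ?_⟩
      have := hPpow k
      rw [← hk, FreeMonoid.toList_ofList, P_linv] at this
      rw [zpow_neg, zpow_natCast, ← this, inv_inv]
  · rintro ⟨k, rfl⟩
    exact hrc.zpow_left k

theorem general (g : CoprodI G)
    (hg : ¬ ∃ (h : CoprodI G) (i : ι) (m : G i), h⁻¹ * g * h = CoprodI.of m)
    (hg1 : g ≠ 1) :
    ∃ c : CoprodI G, ∀ x : CoprodI G, Commute x g ↔ ∃ k : ℤ, x = c ^ k := by
  classical
  have hex : ∃ n, ∃ L : List (Σ i, G i), (∃ h : CoprodI G, h⁻¹ * g * h = P L) ∧ L.length = n := by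
    obtain ⟨L, -, hL⟩ := P_surj g
    exact ⟨_, L, ⟨1, by simp [hL]⟩, rfl⟩
  obtain ⟨L, ⟨h, hh⟩, hn⟩ := Nat.find_spec hex
  have hmin : ∀ M : List (Σ i, G i), (∃ h : CoprodI G, h⁻¹ * g * h = P M) → L.length ≤ M.length := by
    intro M hM
    rw [hn]
    exact Nat.find_min' hex ⟨M, hM, rfl⟩
  have hred : ∀ M : List (Σ i, G i), (∃ h : CoprodI G, h⁻¹ * g * h = P M) →
      M.length = L.length → Red M := by
    intro M hM hl
    rcases shorten M with hR | ⟨M', hP, hlt⟩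
    · exact hR
    · have := hmin M' (hP ▸ hM)
      omega
  have hLred := hred L ⟨h, hh⟩ rfl
  have hLform : ∃ a M b, L = a :: (M ++ [b]) := by
    rcases L with _ | ⟨a, L⟩
    · exfalso
      apply hg1
      have : h⁻¹ * g * h = 1 := by simpa [P] using hh
      have h2 : h * (h⁻¹ * g * h) * h⁻¹ = 1 := by rw [this]; simp
      simpa [mul_assoc] using h2
    · rcases List.eq_nil_or_concat L with rfl | ⟨M, b, rfl⟩
      · exact absurd ⟨h, a.1, a.2, by simpa [P] using hh⟩ hg
      · exact ⟨a, M, b, by simp⟩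
  obtain ⟨a, M, b, rfl⟩ := hLform
  have hab : a.1 ≠ b.1 := by
    have hR : Red ((M ++ [b]) ++ [a]) := by
      refine hred _ ⟨h * CoprodI.of a.2, ?_⟩ (by simp)
      have : (h * CoprodI.of a.2)⁻¹ * g * (h * CoprodI.of a.2) =
          (CoprodI.of a.2)⁻¹ * (h⁻¹ * g * h) * CoprodI.of a.2 := by group
      rw [this, hh, P_cons, P_append (M ++ [b])]
      simp [P, mul_assoc]
    exact ((List.isChain_append.1 hR.2).2.2 b (by simp) a (by simp)).symm
  obtain ⟨c, hc⟩ := cyc_case a b M hab hLred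
  refine ⟨h * c * h⁻¹, fun x => ?_⟩
  have h1 : Commute x g ↔ Commute (h⁻¹ * x * h) (P (a :: (M ++ [b]))) := by
    rw [← hh]
    simpa using (Commute.conj_iff (a := x) (b := g) h⁻¹).symm
  rw [h1, hc]
  refine exists_congr fun k => ?_
  rw [conj_zpow]
  constructor
  · intro h2; rw [← h2]; group
  · intro h2; rw [h2]; group

universe u v

/-- the two-element family -/
def Fam (A : Type u) (B : Type v) : Bool → Type (max u v)
  | true => ULift.{v} A
  | false => ULift.{u} B

instance famGroup (A : Type u) (B : Type v) [Group A] [Group B] : ∀ i, Group (Fam A B i)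
  | true => inferInstanceAs (Group (ULift.{v} A))
  | false => inferInstanceAs (Group (ULift.{u} B))

/-- left factor -/
def iA (A : Type u) (B : Type v) [Group A] [Group B] : A ≃* Fam A B true :=
  (MulEquiv.ulift (α := A)).symm

/-- right factor -/
def iB (A : Type u) (B : Type v) [Group A] [Group B] : B ≃* Fam A B false :=
  (MulEquiv.ulift (α := B)).symm

/-- comparison of the two free products, forward -/
def fwd (A : Type u) (B : Type v) [Group A] [Group B] : Coprod A B →* CoprodI (Fam A B) :=
  Coprod.lift (CoprodI.of.comp (iA A B).toMonoidHom) (CoprodI.of.comp (iB A B).toMonoidHom)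

/-- components of the backward map -/
def bwdAux (A : Type u) (B : Type v) [Group A] [Group B] : ∀ i, Fam A B i →* Coprod A B
  | true => Coprod.inl.comp (iA A B).symm.toMonoidHom
  | false => Coprod.inr.comp (iB A B).symm.toMonoidHom

/-- comparison of the two free products, backward -/
def bwd (A : Type u) (B : Type v) [Group A] [Group B] : CoprodI (Fam A B) →* Coprod A B :=
  CoprodI.lift (bwdAux A B)

/-- comparison of the two free products -/
def cmp (A : Type u) (B : Type v) [Group A] [Group B] : Coprod A B ≃* CoprodI (Fam A B) :=
  MonoidHom.toMulEquiv (fwd A B) (bwd A B)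
    (by
      ext x
      · simp [fwd, bwd, bwdAux]
      · simp [fwd, bwd, bwdAux])
    (by
      refine CoprodI.ext_hom _ _ fun i => ?_
      ext x
      cases i <;> simp [fwd, bwd, bwdAux])

end CentFP

/-- In a free product `A ∗ B` of nontrivial groups, if the conjugacy class of `g` does not meet
the canonical images of `A` and `B`, then the centralizer of `g` contains `g`, is generated by a
single element, and `g` is a power of that generator. -/
theorem centralizer_cyclic_of_conjClass_misses_factors
    (A B : Type*) [Group A] [Group B] [Nontrivial A] [Nontrivial B]
    (g : Monoid.Coprod A B)
    (hA : ¬ ∃ (h : Monoid.Coprod A B) (a : A), h⁻¹ * g * h = Coprod.inl a)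
    (hB : ¬ ∃ (h : Monoid.Coprod A B) (b : B), h⁻¹ * g * h = Coprod.inr b) :
    g ∈ Subgroup.centralizer {g} ∧
      ∃ c : Monoid.Coprod A B, Subgroup.centralizer {g} = Subgroup.zpowers c ∧
        ∃ n : ℤ, g = c ^ n := by
  have hmem : g ∈ Subgroup.centralizer {g} := by
    simp [Subgroup.mem_centralizer_iff]
  refine ⟨hmem, ?_⟩
  let e := CentFP.cmp A B
  obtain ⟨c, hc⟩ := CentFP.general (e g)
    (by
      rintro ⟨h, i, m, hm⟩
      have h2 := congrArg e.symm hm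
      simp only [map_mul, map_inv, MulEquiv.symm_apply_apply] at h2
      have h3 : e.symm (CoprodI.of m) = CentFP.bwdAux A B i m :=
        CoprodI.lift_of (CentFP.bwdAux A B) m
      rw [h3] at h2
      cases i
      · exact hB ⟨_, _, h2⟩
      · exact hA ⟨_, _, h2⟩)
    (by
      intro h1
      have : g = 1 := by simpa using h1
      exact hA ⟨1, 1, by simp [this]⟩)
  have heq : Subgroup.centralizer {g} = Subgroup.zpowers (e.symm c) := by
    ext x
    rw [Subgroup.mem_centralizer_singleton_iff, Subgroup.mem_zpowers_iff]
    have h1 : x * g = g * x ↔ Commute (e x) (e g) := by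
      rw [commute_iff_eq, ← map_mul, ← map_mul, e.injective.eq_iff]
    rw [h1, hc]
    refine exists_congr fun k => ?_
    rw [← map_zpow, MulEquiv.symm_apply_eq, eq_comm]
  refine ⟨e.symm c, heq, ?_⟩
  rw [heq, Subgroup.mem_zpowers_iff] at hmem
  obtain ⟨n, hn⟩ := hmem
  exact ⟨n, hn.symm⟩
end
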